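/- arXiv:2211.03302 — 2 statements merged into one kernel-verified Lean document; each statement's English description precedes it below -/
import Mathlib

section
/- (KL-divergence bound on incentivizable costs under general information structures) There are n tasks, each with binary state ω_i ∈ {0,1} uniform and independent. Exerting effort on task i at cost c_i > 0 yields a posterior belief μ_i ∈ Δ({0,1}) for ω_i drawn from a finite-support distribution f_i satisfying Bayes plausibility E_{μ_i∼f_i}[μ_i] = uniform, independently across tasks; without effort the belief stays at the uniform prior. Let Λ_i = E_{μ_i∼f_i}[KL(uniform ∥ μ_i)], where KL(D ∥ μ) = Σ_{ω∈{0,1}} D(ω)·ln(D(ω)/μ(ω)). Suppose there is a mechanism with payments (scores) in [0,1] in which exerting effort on the set Ψ* and truthfully reporting all realized posteriors maximizes the agent's expected utility over all strategies, including exerting no effort and reporting an arbitrary (possibly randomized) profile of posteriors. Then Σ_{i∈Ψ*} c_i ≤ √((1/2)·Σ_{i∈Ψ*} Λ_i). -/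
open Finset

namespace GI

/-- Expectation of `g` over state profiles when the states are independent and
state `i` equals `1` (i.e. `true`) with probability `ρ i`. -/
noncomputable def stExp {n : ℕ} (ρ : Fin n → ℝ) (g : (Fin n → Bool) → ℝ) : ℝ :=
  ∑ ω : Fin n → Bool, (∏ i, if ω i then ρ i else 1 - ρ i) * g ω

/-- Probability of the signal profile `σ` when effort is exerted exactly on `Ψ`:
on `Ψ` the signal of task `i` is drawn with weights `w i`, off `Ψ` the signal is
the (uninformative) default. -/
noncomputable def wt {n : ℕ} {K : Type*} [Fintype K] [DecidableEq K] [Inhabited K]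
    (w : Fin n → K → ℝ) (Ψ : Finset (Fin n)) (σ : Fin n → K) : ℝ :=
  ∏ i, if i ∈ Ψ then w i (σ i) else (if σ i = default then 1 else 0)

/-- The profile of true posteriors (as probabilities of state 1) induced by
signals `σ` when effort is exerted on `Ψ`: `q i (σ i)` on `Ψ`, the uniform
prior `1/2` off `Ψ`. -/
noncomputable def rep {n : ℕ} {K : Type*} (q : Fin n → K → ℝ) (Ψ : Finset (Fin n))
    (σ : Fin n → K) : Fin n → ℝ :=
  fun i => if i ∈ Ψ then q i (σ i) else 1/2

/-- Expected utility of exerting effort on `Ψ` and reporting via `r`,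
given payment rule `Pay` (a function of reported posterior profile and states). -/
noncomputable def genU {n : ℕ} {K : Type*} [Fintype K] [DecidableEq K] [Inhabited K]
    (w q : Fin n → K → ℝ) (c : Fin n → ℝ)
    (Pay : (Fin n → ℝ) → (Fin n → Bool) → ℝ)
    (Ψ : Finset (Fin n)) (r : (Fin n → K) → (Fin n → ℝ)) : ℝ :=
  (∑ σ : Fin n → K, wt w Ψ σ * stExp (rep q Ψ σ) (Pay (r σ))) - ∑ i ∈ Ψ, c i

end GI

namespace GI

/-- The pointwise inequality behind Pinsker's inequality. -/
theorem three_mul_sub_one_sq_le {t : ℝ} (ht : 0 < t) :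
    3 * (t - 1) ^ 2 ≤ (2 * t + 4) * (t * Real.log t - t + 1) := by
  let ψ : ℝ → ℝ := fun x => Real.log x - (3 / 2) * ((x - 1) * (x + 5) / (x + 2) ^ 2)
  let φ : ℝ → ℝ := fun x => x * Real.log x - x + 1 - (3 / 2) * ((x - 1) ^ 2 / (x + 2))
  have hψ : ∀ x ∈ Set.Ioi (0 : ℝ), HasDerivAt ψ (1 / x - 27 / (x + 2) ^ 3) x := by
    intro x hx
    have hx0 : 0 < x := hx
    have h := (Real.hasDerivAt_log hx0.ne').sub
      (((((hasDerivAt_id x).sub_const 1).mul ((hasDerivAt_id x).add_const 5)).div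
        (((hasDerivAt_id x).add_const 2).pow 2)
        (by simp only [Pi.pow_apply, id]; positivity)).const_mul (3 / 2))
    refine h.congr_deriv ?_
    simp only [Pi.pow_apply, Pi.mul_apply, id]
    field_simp
    ring
  have hφ : ∀ x ∈ Set.Ioi (0 : ℝ), HasDerivAt φ (ψ x) x := by
    intro x hx
    have hx0 : 0 < x := hx
    have h := ((((hasDerivAt_id x).mul (Real.hasDerivAt_log hx0.ne')).sub
      (hasDerivAt_id x)).add_const 1).sub
      (((((hasDerivAt_id x).sub_const 1).pow 2).div ((hasDerivAt_id x).add_const 2)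
        (by simp only [id]; positivity)).const_mul (3 / 2))
    refine h.congr_deriv ?_
    simp only [Pi.pow_apply, id, ψ]
    field_simp
    ring
  have hmono : MonotoneOn ψ (Set.Ioi 0) := by
    refine monotoneOn_of_deriv_nonneg (convex_Ioi 0)
      (fun x hx => (hψ x hx).continuousAt.continuousWithinAt) ?_ ?_
    · rw [interior_Ioi]
      exact fun x hx => (hψ x hx).differentiableAt.differentiableWithinAt
    · rw [interior_Ioi]
      intro x hx
      have hx0 : 0 < x := hx
      rw [(hψ x hx).deriv, sub_nonneg, div_le_div_iff₀ (by positivity) hx0]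
      nlinarith [mul_nonneg (sq_nonneg (x - 1)) (by positivity : (0 : ℝ) ≤ x + 8)]
  have hψ1 : ψ 1 = 0 := by simp [ψ]
  have hφ1 : φ 1 = 0 := by simp [φ]
  have hφt : 0 ≤ φ t := by
    rcases lt_trichotomy t 1 with h | h | h
    · obtain ⟨x, hx, hslope⟩ := exists_hasDerivAt_eq_slope φ ψ h
        (fun y hy => (hφ y (ht.trans_le hy.1)).continuousAt.continuousWithinAt)
        (fun y hy => hφ y (ht.trans hy.1))
      have hle : ψ x ≤ 0 := hψ1 ▸ hmono (ht.trans hx.1) (Set.mem_Ioi.2 one_pos) hx.2.le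
      rw [hslope, hφ1, div_le_iff₀ (sub_pos.2 h)] at hle
      linarith
    · rw [h, hφ1]
    · obtain ⟨x, hx, hslope⟩ := exists_hasDerivAt_eq_slope φ ψ h
        (fun y hy => (hφ y (one_pos.trans_le hy.1)).continuousAt.continuousWithinAt)
        (fun y hy => hφ y (one_pos.trans hy.1))
      have hle : 0 ≤ ψ x :=
        hψ1 ▸ hmono (Set.mem_Ioi.2 one_pos) (one_pos.trans hx.1) hx.1.le
      rw [hslope, hφ1, le_div_iff₀ (sub_pos.2 h)] at hle
      linarith
  have hφ_eq : (2 * t + 4) * (t * Real.log t - t + 1) - 3 * (t - 1) ^ 2 =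
      (2 * t + 4) * φ t := by
    simp only [φ]
    field_simp
    ring
  have := mul_nonneg (by positivity : 0 ≤ 2 * t + 4) hφt
  linarith

theorem three_mul_sub_sq_le {a b : ℝ} (ha : 0 ≤ a) (hb : 0 ≤ b) (hab : b = 0 → a = 0) :
    3 * (a - b) ^ 2 ≤ (2 * a + 4 * b) * (a * Real.log (a / b) - a + b) := by
  rcases hb.eq_or_lt' with hb0 | hb0
  · simp [hb0, hab hb0]
  rcases ha.eq_or_lt' with ha0 | ha0
  · subst ha0
    norm_num
    nlinarith [sq_nonneg b]
  have h := mul_le_mul_of_nonneg_left (three_mul_sub_one_sq_le (div_pos ha0 hb0)) (sq_nonneg b)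
  calc 3 * (a - b) ^ 2 = b ^ 2 * (3 * (a / b - 1) ^ 2) := by field_simp
    _ ≤ _ := h
    _ = _ := by field_simp

/-- **Pinsker's inequality** for finitely supported distributions. -/
theorem sum_abs_sub_sq_le {ι : Type*} (s : Finset ι) (a b : ι → ℝ)
    (ha : ∀ i ∈ s, 0 ≤ a i) (hb : ∀ i ∈ s, 0 ≤ b i) (hab : ∀ i ∈ s, b i = 0 → a i = 0)
    (ha1 : ∑ i ∈ s, a i = 1) (hb1 : ∑ i ∈ s, b i = 1) :
    (∑ i ∈ s, |a i - b i|) ^ 2 ≤ 2 * ∑ i ∈ s, a i * Real.log (a i / b i) := by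
  have hpt : ∀ i ∈ s, |a i - b i| ^ 2 ≤
      ((2 * a i + 4 * b i) / 3) * (a i * Real.log (a i / b i) - a i + b i) := by
    intro i hi
    rw [sq_abs]
    linarith [three_mul_sub_sq_le (ha i hi) (hb i hi) (hab i hi)]
  have hnonneg : ∀ i ∈ s, 0 ≤ (2 * a i + 4 * b i) / 3 := fun i hi => by
    linarith [ha i hi, hb i hi]
  have hnonneg' : ∀ i ∈ s, 0 ≤ a i * Real.log (a i / b i) - a i + b i := by
    intro i hi
    rcases (hb i hi).eq_or_lt' with h0 | h0
    · simp [h0, hab i hi h0]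
    · refine nonneg_of_mul_nonneg_right ((sq_nonneg _).trans (hpt i hi)) ?_
      linarith [ha i hi]
  refine (sum_sq_le_sum_mul_sum_of_sq_le_mul s hnonneg hnonneg' hpt).trans_eq ?_
  rw [← Finset.sum_div, Finset.sum_add_distrib, ← Finset.mul_sum, ← Finset.mul_sum,
    Finset.sum_add_distrib, Finset.sum_sub_distrib, ha1, hb1]
  ring

/-- A `[0,1]`-valued function has expectations differing by at most `√(KL / 2)`. -/
theorem sum_sub_mul_le_sqrt {ι : Type*} (s : Finset ι) (a b f : ι → ℝ)
    (ha : ∀ i ∈ s, 0 ≤ a i) (hb : ∀ i ∈ s, 0 ≤ b i) (hab : ∀ i ∈ s, b i = 0 → a i = 0)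
    (ha1 : ∑ i ∈ s, a i = 1) (hb1 : ∑ i ∈ s, b i = 1) (hf : ∀ i ∈ s, f i ∈ Set.Icc (0 : ℝ) 1) :
    ∑ i ∈ s, (b i - a i) * f i ≤
      √((1 / 2) * ∑ i ∈ s, a i * Real.log (a i / b i)) := by
  have hle : ∑ i ∈ s, (b i - a i) * f i ≤ (1 / 2) * ∑ i ∈ s, |a i - b i| := by
    have hcenter : ∑ i ∈ s, (b i - a i) * f i = ∑ i ∈ s, (b i - a i) * (f i - 1 / 2) := by
      simp only [mul_sub, Finset.sum_sub_distrib, ← Finset.sum_mul, ha1, hb1]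
      ring
    rw [hcenter, Finset.mul_sum]
    refine Finset.sum_le_sum fun i hi => (le_abs_self _).trans ?_
    rw [abs_mul, abs_sub_comm, mul_comm]
    refine mul_le_mul_of_nonneg_right (abs_le.2 ⟨?_, ?_⟩) (abs_nonneg _) <;>
      linarith [(hf i hi).1, (hf i hi).2]
  refine hle.trans (Real.le_sqrt_of_sq_le ?_)
  linarith [sum_abs_sub_sq_le s a b ha hb hab ha1 hb1,
    mul_pow (1 / 2) (∑ i ∈ s, |a i - b i|) 2]

/-- Marginalization of a product distribution to one coordinate. -/
theorem sum_prod_mul_apply {ι κ : Type*} [Fintype ι] [DecidableEq ι] [Fintype κ]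
    (u : ι → κ → ℝ) (hu : ∀ i, ∑ j, u i j = 1) (i₀ : ι) (h : κ → ℝ) :
    ∑ x : ι → κ, (∏ i, u i (x i)) * h (x i₀) = ∑ j, u i₀ j * h j := by
  have hsplit : ∀ x : ι → κ, (∏ i, u i (x i)) * h (x i₀) =
      ∏ i, u i (x i) * (if i = i₀ then h (x i) else 1) := fun x => by
    rw [Finset.prod_mul_distrib, Finset.prod_ite_eq' Finset.univ i₀]
    simp
  simp_rw [hsplit]
  rw [← Fintype.prod_sum (fun i j => u i j * (if i = i₀ then h j else 1)),
    Finset.prod_eq_single i₀]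
  · simp
  · intro i _ hi
    simp [hi, hu]
  · simp

/-- The probability of the state profile `ω` under independent states with marginals `ρ`. -/
noncomputable def stWeight {n : ℕ} (ρ : Fin n → ℝ) (ω : Fin n → Bool) : ℝ :=
  ∏ i, if ω i then ρ i else 1 - ρ i

theorem sum_stWeight {n : ℕ} (ρ : Fin n → ℝ) : ∑ ω, stWeight ρ ω = 1 := by
  unfold stWeight
  rw [← Fintype.prod_sum (fun i (b : Bool) => if b then ρ i else 1 - ρ i)]
  simp

theorem stWeight_pos {n : ℕ} {ρ : Fin n → ℝ} (hρ : ∀ i, 0 < ρ i ∧ ρ i < 1)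
    (ω : Fin n → Bool) : 0 < stWeight ρ ω :=
  Finset.prod_pos fun i _ => by split_ifs <;> linarith [(hρ i).1, (hρ i).2]

/-- The divergence `KL(uniform ∥ (1 - x, x))`. -/
noncomputable def unifKL (x : ℝ) : ℝ :=
  (1 / 2) * Real.log ((1 / 2) / x) + (1 / 2) * Real.log ((1 / 2) / (1 - x))

theorem unifKL_half : unifKL (1 / 2) = 0 := by norm_num [unifKL]

/-- Additivity of the divergence over independent states. -/
theorem sum_stWeight_mul_log {n : ℕ} {ρ : Fin n → ℝ} (hρ : ∀ i, 0 < ρ i ∧ ρ i < 1) :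
    ∑ ω, stWeight (fun _ : Fin n => 1 / 2) ω *
      Real.log (stWeight (fun _ => 1 / 2) ω / stWeight ρ ω) = ∑ i, unifKL (ρ i) := by
  have hlog : ∀ ω : Fin n → Bool, Real.log (stWeight (fun _ => 1 / 2) ω / stWeight ρ ω) =
      ∑ i, Real.log ((1 / 2) / (if ω i then ρ i else 1 - ρ i)) := by
    intro ω
    unfold stWeight
    rw [← Finset.prod_div_distrib, Real.log_prod]
    · refine Finset.sum_congr rfl fun i _ => ?_
      norm_num
    · intro i _
      refine div_ne_zero (by norm_num) ?_
      split_ifs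
      · exact (hρ i).1.ne'
      · exact (sub_pos.2 (hρ i).2).ne'
  simp_rw [hlog, Finset.mul_sum]
  rw [Finset.sum_comm]
  refine Finset.sum_congr rfl fun i _ => ?_
  refine (sum_prod_mul_apply (fun _ (b : Bool) => if b then (1 / 2 : ℝ) else 1 - 1 / 2)
    (fun _ => by simp) i
    (fun b => Real.log ((1 / 2) / (if b then ρ i else 1 - ρ i)))).trans ?_
  norm_num [unifKL]

section Signals

variable {n : ℕ} {K : Type*} [Fintype K] [DecidableEq K] [Inhabited K] {w q : Fin n → K → ℝ}

theorem sum_wt_mul_apply (hw1 : ∀ i, ∑ j, w i j = 1) {Ψ : Finset (Fin n)} {i : Fin n}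
    (hi : i ∈ Ψ) (h : K → ℝ) : ∑ σ, wt w Ψ σ * h (σ i) = ∑ j, w i j * h j := by
  refine (sum_prod_mul_apply
    (fun i j => if i ∈ Ψ then w i j else (if j = default then 1 else 0))
    (fun i => ?_) i h).trans (by simp [hi])
  split_ifs
  · exact hw1 i
  · simp

theorem sum_wt (hw1 : ∀ i, ∑ j, w i j = 1) (Ψ : Finset (Fin n)) : ∑ σ, wt w Ψ σ = 1 := by
  unfold wt
  rw [← Fintype.prod_sum
    (fun i j => if i ∈ Ψ then w i j else (if j = default then (1 : ℝ) else 0))]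
  refine Finset.prod_eq_one fun i _ => ?_
  split_ifs
  · exact hw1 i
  · simp

theorem wt_nonneg (hw : ∀ i j, 0 ≤ w i j) (Ψ : Finset (Fin n)) (σ : Fin n → K) :
    0 ≤ wt w Ψ σ :=
  Finset.prod_nonneg fun i _ => by
    split_ifs
    exacts [hw _ _, zero_le_one, le_rfl]

theorem rep_mem_Ioo_of_wt_ne_zero (hw : ∀ i j, 0 ≤ w i j)
    (hq : ∀ i j, 0 < w i j → 0 < q i j ∧ q i j < 1) {Ψ : Finset (Fin n)} {σ : Fin n → K}
    (hσ : wt w Ψ σ ≠ 0) (i : Fin n) : 0 < rep q Ψ σ i ∧ rep q Ψ σ i < 1 := by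
  have hi := Finset.prod_ne_zero_iff.1 hσ i (Finset.mem_univ i)
  by_cases h : i ∈ Ψ
  · simp only [rep, h, if_true] at hi ⊢
    exact hq _ _ ((hw _ _).lt_of_ne' hi)
  · norm_num [rep, h]

theorem sum_wt_mul_sum_unifKL (hw1 : ∀ i, ∑ j, w i j = 1) (Ψ : Finset (Fin n)) :
    ∑ σ, wt w Ψ σ * ∑ i, unifKL (rep q Ψ σ i) =
      ∑ i ∈ Ψ, ∑ j, w i j * unifKL (q i j) := by
  have hrep : ∀ σ : Fin n → K,
      ∑ i, unifKL (rep q Ψ σ i) = ∑ i ∈ Ψ, unifKL (q i (σ i)) := by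
    intro σ
    rw [← Finset.sum_subset (Finset.subset_univ Ψ)]
    · exact Finset.sum_congr rfl fun i hi => by simp [rep, hi]
    · intro i _ hi
      simp only [rep, hi, if_false]
      exact unifKL_half
  simp_rw [hrep, Finset.mul_sum]
  rw [Finset.sum_comm]
  exact Finset.sum_congr rfl fun i hi => sum_wt_mul_apply hw1 hi fun j => unifKL (q i j)

/-- Exerting no effort and drawing the report from the truthful distribution loses at most
`√(KL / 2)` of the expected payment. -/
theorem sum_wt_mul_stExp_sub_le (hw : ∀ i j, 0 ≤ w i j) (hw1 : ∀ i, ∑ j, w i j = 1)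
    (hq : ∀ i j, 0 < w i j → 0 < q i j ∧ q i j < 1)
    {Pay : (Fin n → ℝ) → (Fin n → Bool) → ℝ} (hPay : ∀ ρ ω, Pay ρ ω ∈ Set.Icc (0 : ℝ) 1)
    (Ψ : Finset (Fin n)) :
    ∑ σ, wt w Ψ σ * (stExp (rep q Ψ σ) (Pay (rep q Ψ σ)) -
        stExp (fun _ => 1 / 2) (Pay (rep q Ψ σ))) ≤
      √((1 / 2) * ∑ i ∈ Ψ, ∑ j, w i j * unifKL (q i j)) := by
  let u : (Fin n → Bool) → ℝ := stWeight fun _ => 1 / 2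
  let a : (Fin n → K) × (Fin n → Bool) → ℝ := fun p => wt w Ψ p.1 * u p.2
  let b : (Fin n → K) × (Fin n → Bool) → ℝ := fun p =>
    wt w Ψ p.1 * stWeight (rep q Ψ p.1) p.2
  have hu : ∀ ω, 0 < u ω := stWeight_pos fun _ => by norm_num
  have hpos : ∀ σ, wt w Ψ σ ≠ 0 → ∀ ω, 0 < stWeight (rep q Ψ σ) ω := fun σ hσ =>
    stWeight_pos (rep_mem_Ioo_of_wt_ne_zero hw hq hσ)
  have key := sum_sub_mul_le_sqrt Finset.univ a b (fun p => Pay (rep q Ψ p.1) p.2)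
    (fun p _ => mul_nonneg (wt_nonneg hw Ψ p.1) (hu p.2).le)
    (fun p _ => by
      by_cases h : wt w Ψ p.1 = 0
      · simp [b, h]
      · exact mul_nonneg (wt_nonneg hw Ψ p.1) (hpos _ h _).le)
    (fun p _ hp => by
      by_cases h : wt w Ψ p.1 = 0
      · simp [a, h]
      · exact absurd hp (mul_ne_zero h (hpos _ h _).ne'))
    (by simp only [a, u, Fintype.sum_prod_type, ← Finset.mul_sum, sum_stWeight, mul_one,
          sum_wt hw1])
    (by simp only [b, Fintype.sum_prod_type, ← Finset.mul_sum, sum_stWeight, mul_one,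
          sum_wt hw1])
    (fun p _ => hPay _ _)
  have hkl : ∑ p, a p * Real.log (a p / b p) =
      ∑ i ∈ Ψ, ∑ j, w i j * unifKL (q i j) := by
    rw [← sum_wt_mul_sum_unifKL hw1, Fintype.sum_prod_type]
    refine Finset.sum_congr rfl fun σ _ => ?_
    by_cases h : wt w Ψ σ = 0
    · simp [a, h]
    · rw [← sum_stWeight_mul_log (rep_mem_Ioo_of_wt_ne_zero hw hq h), Finset.mul_sum]
      refine Finset.sum_congr rfl fun ω _ => ?_
      simp only [a, b, u, mul_div_mul_left _ _ h, mul_assoc]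
  rw [hkl] at key
  refine le_of_eq_of_le ?_ key
  rw [Fintype.sum_prod_type]
  refine Finset.sum_congr rfl fun σ _ => ?_
  unfold stExp
  rw [← Finset.sum_sub_distrib, Finset.mul_sum]
  refine Finset.sum_congr rfl fun ω _ => ?_
  simp only [a, b, u, stWeight]
  ring

theorem genU_empty_const (hw1 : ∀ i, ∑ j, w i j = 1) (c : Fin n → ℝ)
    (Pay : (Fin n → ℝ) → (Fin n → Bool) → ℝ) (ρ : Fin n → ℝ) :
    genU w q c Pay ∅ (fun _ => ρ) = stExp (fun _ => 1 / 2) (Pay ρ) := by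
  have hrep : ∀ σ : Fin n → K, rep q ∅ σ = fun _ => 1 / 2 := fun σ => by
    funext i
    simp [rep]
  simp only [genU, hrep, ← Finset.sum_mul, sum_wt hw1, one_mul, Finset.sum_empty, sub_zero]

end Signals

end GI

/-- KL-divergence bound on incentivizable costs under general information
structures: if truthful effort on `Ψ*` maximizes the agent's expected utility
over all effort sets and reporting strategies, then
`∑_{i∈Ψ*} c i ≤ √((1/2) ∑_{i∈Ψ*} Λ i)` where `Λ i` is the expected KL divergence
between the uniform prior and the posterior on task `i`. -/
theorem stmt16 {n : ℕ} {K : Type*} [Fintype K] [DecidableEq K] [Inhabited K]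
    (c : Fin n → ℝ) (hc : ∀ i, 0 < c i)
    (w q : Fin n → K → ℝ)
    (hw : ∀ i j, 0 ≤ w i j) (hw1 : ∀ i, ∑ j, w i j = 1)
    (hq : ∀ i j, 0 < w i j → 0 < q i j ∧ q i j < 1)
    (hbayes : ∀ i, ∑ j, w i j * q i j = 1/2)
    (Λ : Fin n → ℝ)
    (hΛ : ∀ i, Λ i = ∑ j, w i j *
      ((1/2) * Real.log ((1/2) / q i j) + (1/2) * Real.log ((1/2) / (1 - q i j))))
    (Pay : (Fin n → ℝ) → (Fin n → Bool) → ℝ)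
    (hPay : ∀ ρ ω, Pay ρ ω ∈ Set.Icc (0:ℝ) 1)
    (Ψstar : Finset (Fin n))
    (hopt : ∀ (Ψ' : Finset (Fin n)) (r : (Fin n → K) → (Fin n → ℝ)),
      GI.genU w q c Pay Ψstar (GI.rep q Ψstar) ≥ GI.genU w q c Pay Ψ' r) :
    ∑ i ∈ Ψstar, c i ≤ Real.sqrt ((1/2) * ∑ i ∈ Ψstar, Λ i) := by
  have hdev : ∑ σ, GI.wt w Ψstar σ * GI.stExp (fun _ => 1 / 2) (Pay (GI.rep q Ψstar σ)) ≤
      GI.genU w q c Pay Ψstar (GI.rep q Ψstar) := by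
    refine le_of_le_of_eq ?_ (by rw [← Finset.sum_mul, GI.sum_wt hw1, one_mul] :
      ∑ σ, GI.wt w Ψstar σ * GI.genU w q c Pay Ψstar (GI.rep q Ψstar) = _)
    refine Finset.sum_le_sum fun σ _ => mul_le_mul_of_nonneg_left ?_ (GI.wt_nonneg hw Ψstar σ)
    rw [← GI.genU_empty_const (q := q) hw1 c]
    exact hopt ∅ _
  have hbound := GI.sum_wt_mul_stExp_sub_le hw hw1 hq hPay Ψstar
  have hΛ' : ∑ i ∈ Ψstar, ∑ j, w i j * GI.unifKL (q i j) = ∑ i ∈ Ψstar, Λ i :=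
    Finset.sum_congr rfl fun i _ => (hΛ i).symm
  rw [hΛ'] at hbound
  simp only [mul_sub, Finset.sum_sub_distrib] at hbound
  unfold GI.genU at hdev
  linarith
end

section
/- (Single-task incentivization under a general information structure) Consider a single task with binary state ω ∈ {0,1} uniform. Exerting effort at cost c > 0 yields a posterior μ ∈ [0,1] (the probability that ω = 1) drawn from a finite-support distribution f with E_{μ∼f}[μ] = 1/2; without effort the belief stays at the prior 1/2. Then there exists a scoring rule S : [0,1] × {0,1} → [0,1] that is proper for belief elicitation and for which exerting effort and truthfully reporting the realized posterior yields expected utility at least that of exerting no effort and reporting the prior, if and only if E_{μ∼f}[|μ − 1/2|] ≥ c. -/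
/-- The scoring rule paying `1` exactly when the state is the one the report deems likelier,
with ties resolved in favour of `true`. -/
noncomputable def thresholdScore (x : ℝ) : Bool → ℝ
  | true => if 1/2 ≤ x then 1 else 0
  | false => if 1/2 ≤ x then 0 else 1

theorem thresholdScore_mem_Icc (x : ℝ) (ω : Bool) : thresholdScore x ω ∈ Set.Icc (0:ℝ) 1 := by
  cases ω <;> unfold thresholdScore <;> split_ifs <;> norm_num

theorem thresholdScore_expected_self (x : ℝ) :
    x * thresholdScore x true + (1 - x) * thresholdScore x false = 1/2 + |x - 1/2| := by
  unfold thresholdScore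
  split_ifs with h
  · rw [abs_of_nonneg (by linarith)]
    ring
  · rw [abs_of_neg (by linarith)]
    ring

theorem thresholdScore_proper (x x' : ℝ) :
    x * thresholdScore x' true + (1 - x) * thresholdScore x' false
      ≤ x * thresholdScore x true + (1 - x) * thresholdScore x false := by
  rw [thresholdScore_expected_self]
  unfold thresholdScore
  split_ifs
  · linarith [le_abs_self (x - 1/2)]
  · linarith [neg_abs_le (x - 1/2)]


/-- Single-task incentivization under a general information structure:
with a binary uniform state, effort yielding a posterior `q j` (probability of
state 1) with probability `w j`, Bayes-plausible (`∑ w j q j = 1/2`), there is a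
scoring rule `S : [0,1] × {0,1} → [0,1]` proper for belief elicitation under
which exerting effort and truthfully reporting the realized posterior is weakly
better than no effort and reporting the prior, iff `E[|μ − 1/2|] ≥ c`. -/
theorem stmt17 (c : ℝ) (hc : 0 < c) (m : ℕ) (w q : Fin m → ℝ)
    (hw : ∀ j, 0 ≤ w j) (hw1 : ∑ j, w j = 1)
    (hq : ∀ j, q j ∈ Set.Icc (0:ℝ) 1)
    (hbayes : ∑ j, w j * q j = 1/2) :
    (∃ S : ℝ → Bool → ℝ,
      (∀ x ω, S x ω ∈ Set.Icc (0:ℝ) 1) ∧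
      (∀ x x', x ∈ Set.Icc (0:ℝ) 1 → x' ∈ Set.Icc (0:ℝ) 1 →
        x * S x true + (1 - x) * S x false ≥ x * S x' true + (1 - x) * S x' false) ∧
      (∑ j, w j * (q j * S (q j) true + (1 - q j) * S (q j) false)) - c
        ≥ (1/2) * S (1/2) true + (1/2) * S (1/2) false)
    ↔ ∑ j, w j * |q j - 1/2| ≥ c := by
  constructor
  · rintro ⟨S, hS, hproper, hinc⟩
    have gain_le (j : Fin m) : q j * S (q j) true + (1 - q j) * S (q j) false
        ≤ (1/2 * S (1/2) true + 1/2 * S (1/2) false) + |q j - 1/2| := by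
      have hprior := hproper (1/2) (q j) (by norm_num) (hq j)
      obtain ⟨ht0, ht1⟩ := hS (q j) true
      obtain ⟨hf0, hf1⟩ := hS (q j) false
      have hslope : |S (q j) true - S (q j) false| ≤ 1 :=
        abs_le.mpr ⟨by linarith, by linarith⟩
      have hmul : (S (q j) true - S (q j) false) * (q j - 1/2) ≤ |q j - 1/2| := by
        refine (le_abs_self _).trans ?_
        rw [abs_mul]
        exact mul_le_of_le_one_left (abs_nonneg _) hslope
      linarith
    have hsum := Finset.sum_le_sum fun j (_ : j ∈ Finset.univ) =>
      mul_le_mul_of_nonneg_left (gain_le j) (hw j)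
    simp only [mul_add (w _) (1/2 * S (1/2) true + 1/2 * S (1/2) false),
      Finset.sum_add_distrib, ← Finset.sum_mul, hw1] at hsum
    linarith
  · intro h
    refine ⟨thresholdScore, thresholdScore_mem_Icc,
      fun x x' _ _ => thresholdScore_proper x x', ?_⟩
    have hprior := thresholdScore_expected_self (1/2)
    norm_num only [abs_zero] at hprior
    simp only [thresholdScore_expected_self, mul_add, Finset.sum_add_distrib,
      ← Finset.sum_mul, hw1]
    norm_num only
    linarith
end
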